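/- For every real ε with 0 < ε < 1/2 there exist positive constants c, C and a natural number N such that for all integers n ≥ N and all k with 3 ≤ k ≤ n^{1/2 − ε}, the choice number of the Kneser graph satisfies c·n·log n ≤ ch(KG_{n,k}) ≤ C·n·log n. That is, for k < n^{0.5 − ε}, ch(KG_{n,k}) = Θ(n·log n). -/

import Mathlib

/-- The Kneser graph `KG_{n,k}`: vertices are the `k`-element subsets of `[n]`,
adjacent iff disjoint. -/
def KneserGraph (n k : ℕ) : SimpleGraph {v : Finset (Fin n) // v.card = k} :=
  SimpleGraph.fromRel (fun u v => Disjoint u.1 v.1)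

/-- `G` is `s`-choosable: every assignment of lists of size `s` admits a proper coloring
from the lists. -/
def Choosable {V : Type*} (G : SimpleGraph V) (s : ℕ) : Prop :=
  ∀ S : V → Finset ℕ, (∀ v, (S v).card = s) →
    ∃ c : V → ℕ, (∀ v, c v ∈ S v) ∧ ∀ u v, G.Adj u v → c u ≠ c v

/-- The choice number of `G`: the least `s` such that `G` is `s`-choosable. -/
noncomputable def choiceNumber {V : Type*} (G : SimpleGraph V) : ℕ :=
  sInf {s | Choosable G s}

lemma Choosable.mono {V : Type*} {G : SimpleGraph V} {s t : ℕ} (h : Choosable G s)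
    (hst : s ≤ t) : Choosable G t := by
  intro S hS
  have hsub : ∀ v, ∃ T ⊆ S v, T.card = s := fun v =>
    Finset.exists_subset_card_eq (by rw [hS v]; exact hst)
  choose T hT hTc using hsub
  obtain ⟨c, hc, hadj⟩ := h T hTc
  exact ⟨c, fun v => hT v (hc v), hadj⟩

lemma Choosable.of_injective_hom {V W : Type*} {G : SimpleGraph V} {H : SimpleGraph W} {s : ℕ}
    (h : Choosable H s) (φ : V → W) (hφ : Function.Injective φ)
    (hadj : ∀ u v, G.Adj u v → H.Adj (φ u) (φ v)) : Choosable G s := by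
  intro S hS
  obtain ⟨c, hc, hne⟩ := h (Function.extend φ S fun _ => Finset.range s) fun w => by
    by_cases hw : ∃ v, φ v = w
    · obtain ⟨v, rfl⟩ := hw
      rw [hφ.extend_apply, hS]
    · rw [Function.extend_apply' _ _ _ hw, Finset.card_range]
  exact ⟨c ∘ φ, fun v => by simpa [hφ.extend_apply] using hc (φ v),
    fun u v huv => hne _ _ (hadj u v huv)⟩

lemma kneserGraph_choosable {n k s : ℕ} (hn : 0 < n)
    (h : (n.choose k : ℝ) * Real.exp (-(k * s / n)) < 1) :
    Choosable (KneserGraph n k) s := by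
  classical
  intro S hS
  let U : Finset ℕ := Finset.univ.biUnion S
  have hSU : ∀ v, S v ⊆ U := fun v => Finset.subset_biUnion_of_mem S (Finset.mem_univ v)
  let bad : {v : Finset (Fin n) // v.card = k} → Finset (U → Fin n) := fun v =>
    Fintype.piFinset fun j => if (j : ℕ) ∈ S v then v.1ᶜ else Finset.univ
  have hbad : ∀ v, ((bad v).card : ℝ) ≤ Real.exp (-(k * s / n)) * (n : ℝ) ^ U.card := by
    intro v
    have hkn : k ≤ n := by
      have := Finset.card_le_univ v.1
      rwa [v.2, Fintype.card_fin] at this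
    have hcard : (bad v).card = (n - k) ^ s * n ^ (U.card - s) := by
      simp only [bad, Fintype.card_piFinset]
      rw [Finset.prod_coe_sort U (fun j => (if j ∈ S v then v.1ᶜ else Finset.univ).card)]
      simp only [apply_ite Finset.card, Finset.card_compl, v.2, Finset.card_univ,
        Fintype.card_fin]
      rw [Finset.prod_ite, Finset.prod_const, Finset.prod_const, Finset.filter_mem_eq_inter,
        Finset.inter_eq_right.2 (hSU v), hS v, Finset.filter_notMem_eq_sdiff,
        Finset.card_sdiff_of_subset (hSU v), hS v]
    have hsU : s ≤ U.card := by rw [← hS v]; exact Finset.card_le_card (hSU v)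
    have hn' : (0 : ℝ) < n := by exact_mod_cast hn
    have h1 : ((n : ℝ) - k) ≤ Real.exp (-(k / n)) * n := by
      have := Real.add_one_le_exp (-(k / n : ℝ))
      calc (n : ℝ) - k = (-(k / n) + 1) * n := by field_simp; ring
        _ ≤ _ := by gcongr
    have h2 : (0 : ℝ) ≤ (n : ℝ) - k := by
      rw [sub_nonneg]; exact_mod_cast hkn
    rw [hcard]
    push_cast [hkn]
    calc ((n : ℝ) - k) ^ s * (n : ℝ) ^ (U.card - s)
        ≤ (Real.exp (-(k / n)) * n) ^ s * (n : ℝ) ^ (U.card - s) := by gcongr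
      _ = Real.exp (-(k / n)) ^ s * ((n : ℝ) ^ s * (n : ℝ) ^ (U.card - s)) := by ring
      _ = _ := by
        rw [← pow_add, Nat.add_sub_cancel' hsU, ← Real.exp_nat_mul]
        congr 2
        ring
  have hex : ∃ f : U → Fin n, ∀ v, f ∉ bad v := by
    by_contra! hcon
    have hcov : (Finset.univ : Finset (U → Fin n)) ⊆ Finset.univ.biUnion bad := fun f _ => by
      simpa using hcon f
    have h1 : (n : ℝ) ^ U.card ≤ ∑ v, ((bad v).card : ℝ) := by
      have := (Finset.card_le_card hcov).trans Finset.card_biUnion_le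
      rw [Finset.card_univ, Fintype.card_fun, Fintype.card_fin, Fintype.card_coe] at this
      exact_mod_cast this
    have h2 := h1.trans (Finset.sum_le_sum fun v _ => hbad v)
    rw [Finset.sum_const, Finset.card_univ, Fintype.card_finset_len, Fintype.card_fin,
      nsmul_eq_mul, ← mul_assoc] at h2
    have h3 : (0 : ℝ) < (n : ℝ) ^ U.card := by positivity
    nlinarith
  obtain ⟨f, hf⟩ := hex
  have hgood : ∀ v, ∃ j : U, (j : ℕ) ∈ S v ∧ f j ∈ v.1 := by
    intro v
    have := hf v
    simp only [bad, Fintype.mem_piFinset, not_forall] at this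
    obtain ⟨j, hj⟩ := this
    by_cases hjS : (j : ℕ) ∈ S v
    · exact ⟨j, hjS, by simpa [hjS] using hj⟩
    · simp [hjS] at hj
  choose c hc hfc using hgood
  refine ⟨fun v => c v, hc, fun u v huv heq => ?_⟩
  have heq' : c u = c v := Subtype.ext heq
  have hdisj : Disjoint u.1 v.1 := by
    rw [KneserGraph, SimpleGraph.fromRel_adj] at huv
    exact huv.2.elim id fun h => h.symm
  exact Finset.disjoint_left.1 hdisj (hfc u) (heq' ▸ hfc v)


/-- If every set of more than `M` vertices spans at least a quarter of its ordered pairs as edges,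
then all independent sets are covered by few sets that are small. -/
lemma exists_containers {V : Type*} [Fintype V] [DecidableEq V] (G : SimpleGraph V)
    [DecidableRel G.Adj] (M : ℕ)
    (hsat : ∀ A : Finset V, M < A.card →
      A.card ^ 2 ≤ 4 * ∑ v ∈ A, (A.filter (G.Adj v)).card) (L : ℕ) :
    ∃ 𝒞 : Finset (Finset V), 𝒞.card ≤ (Fintype.card V + 1) ^ L ∧
      ∀ I : Finset V, (∀ u ∈ I, ∀ v ∈ I, ¬ G.Adj u v) →
        ∃ C ∈ 𝒞, I ⊆ C ∧ (C.card ≤ M ∨ 8 ^ L * C.card ≤ 7 ^ L * Fintype.card V) := by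
  induction L with
  | zero =>
    exact ⟨{Finset.univ}, by simp, fun I _ => ⟨Finset.univ, by simp, by simp, by simp⟩⟩
  | succ L ih =>
    obtain ⟨𝒞, hcard, h𝒞⟩ := ih
    let step : Finset V × Option V → Finset V := fun p => p.2.elim
      (p.1.filter fun v => 8 * (p.1.filter (G.Adj v)).card < p.1.card)
      (fun v => p.1.filter fun w => ¬ G.Adj v w)
    refine ⟨(𝒞 ×ˢ (Finset.univ : Finset (Option V))).image step, ?_, fun I hI => ?_⟩
    · refine Finset.card_image_le.trans ?_
      rw [Finset.card_product, Finset.card_univ, Fintype.card_option, pow_succ]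
      gcongr
    obtain ⟨A, hA, hIA, hsize⟩ := h𝒞 I hI
    have key : ∃ o, I ⊆ step (A, o) ∧ ((step (A, o)).card ≤ M ∨
        8 * (step (A, o)).card ≤ 7 * A.card) := by
      by_cases hdeg : ∃ v ∈ I, A.card ≤ 8 * (A.filter (G.Adj v)).card
      · obtain ⟨v, hv, hd⟩ := hdeg
        refine ⟨some v, fun w hw => ?_, Or.inr ?_⟩
        · simp [step, hIA hw, hI v hv w hw]
        · have := Finset.card_filter_add_card_filter_not (s := A) (G.Adj v)
          simp only [step, Option.elim]
          omega
      · push Not at hdeg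
        refine ⟨none, fun w hw => ?_, ?_⟩
        · simp only [step, Option.elim, Finset.mem_filter]
          exact ⟨hIA hw, hdeg w hw⟩
        · simp only [step, Option.elim]
          set A' := A.filter fun v => 8 * (A.filter (G.Adj v)).card < A.card with hA'
          by_cases hM : A'.card ≤ M
          · exact Or.inl hM
          right
          have h1 := hsat A' (not_le.1 hM)
          have h2 : ∑ v ∈ A', 8 * (A'.filter (G.Adj v)).card ≤ A'.card * A.card := by
            rw [← smul_eq_mul]
            refine Finset.sum_le_card_nsmul _ _ _ fun v hv => ?_
            have h3 := (Finset.mem_filter.1 hv).2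
            have h4 : (A'.filter (G.Adj v)).card ≤ (A.filter (G.Adj v)).card :=
              Finset.card_le_card (Finset.filter_subset_filter _ (Finset.filter_subset _ _))
            omega
          rw [← Finset.mul_sum] at h2
          have h5 : 0 < A'.card := by omega
          have h6 : 2 * A'.card ≤ A.card := by
            by_contra! hlt
            nlinarith
          omega
    obtain ⟨o, hIo, ho⟩ := key
    refine ⟨step (A, o), Finset.mem_image_of_mem _ (by simp [hA]), hIo, ?_⟩
    have hle : (step (A, o)).card ≤ A.card := by
      refine Finset.card_le_card ?_
      cases o <;> exact Finset.filter_subset _ _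
    rcases ho with ho | ho
    · exact Or.inl ho
    rcases hsize with hs | hs
    · exact Or.inl (hle.trans hs)
    right
    calc 8 ^ (L + 1) * (step (A, o)).card = 8 ^ L * (8 * (step (A, o)).card) := by ring
      _ ≤ 8 ^ L * (7 * A.card) := by gcongr
      _ = 7 * (8 ^ L * A.card) := by ring
      _ ≤ 7 * (7 ^ L * Fintype.card V) := by gcongr
      _ = _ := by ring

lemma choose_le_three_pow_mul_choose {m s t : ℕ} (h : 3 * s + 2 * t ≤ 2 * m) :
    m.choose s ≤ 3 ^ t * (m - t).choose s := by
  induction t with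
  | zero => simp
  | succ t ih =>
    refine (ih (by omega)).trans ?_
    rw [pow_succ, mul_assoc]
    refine Nat.mul_le_mul_left _ ?_
    obtain ⟨r, hr⟩ : ∃ r, m - t = r + 1 := ⟨m - t - 1, by omega⟩
    have hr' : m - (t + 1) = r := by omega
    rw [hr, hr']
    have h1 := Nat.choose_mul_succ_eq r s
    have h2 : r + 1 ≤ 3 * (r + 1 - s) := by omega
    refine Nat.le_of_mul_le_mul_right (c := r + 1 - s) ?_ (by omega)
    rw [← h1]
    nlinarith [Nat.zero_le (r.choose s)]

/-- Uniformly random lists from `2 * s` colors show that a graph whose independent sets are covered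
by few small sets is not `s`-choosable. -/
lemma not_choosable_of_containers {V : Type*} [Fintype V] [DecidableEq V] (G : SimpleGraph V)
    (𝒞 : Finset (Finset V)) (M s t : ℕ)
    (hcov : ∀ I : Finset V, (∀ u ∈ I, ∀ v ∈ I, ¬ G.Adj u v) → ∃ C ∈ 𝒞, I ⊆ C)
    (hM : ∀ C ∈ 𝒞, C.card ≤ M) (hst : 4 * s * M ≤ Fintype.card V * (t + 1)) (hts : 2 * t ≤ s)
    (hlog : 2 * s * Real.log 𝒞.card < Fintype.card V / (2 * 3 ^ t)) :
    ¬ Choosable G s := by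
  intro hch
  let P : Finset (Finset (Fin (2 * s))) := Finset.univ.powersetCard s
  let B : (Fin (2 * s) → Finset V) → Finset (V → Finset (Fin (2 * s))) := fun C =>
    Fintype.piFinset fun v => P.filter fun L => ∃ j ∈ L, v ∈ C j
  have hPcard : P.card = (2 * s).choose s := by simp [P]
  have hPpos : (0 : ℝ) < P.card := by
    rw [hPcard]; exact_mod_cast Nat.choose_pos (by omega)
  have hcover : Fintype.piFinset (fun _ : V => P) ⊆
      (Fintype.piFinset fun _ : Fin (2 * s) => 𝒞).biUnion B := by
    intro S hS
    rw [Fintype.mem_piFinset] at hS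
    obtain ⟨c, hc, hne⟩ := hch (fun v => (S v).map Fin.valEmbedding) fun v => by
      rw [Finset.card_map]; exact (Finset.mem_powersetCard.1 (hS v)).2
    have hcont : ∀ j : Fin (2 * s), ∃ C ∈ 𝒞, Finset.univ.filter (fun v => c v = j) ⊆ C := by
      intro j
      refine hcov _ fun u hu v hv huv => hne u v huv ?_
      rw [(Finset.mem_filter.1 hu).2, (Finset.mem_filter.1 hv).2]
    choose C hC hsub using hcont
    refine Finset.mem_biUnion.2 ⟨C, Fintype.mem_piFinset.2 hC, ?_⟩
    refine Fintype.mem_piFinset.2 fun v => Finset.mem_filter.2 ⟨hS v, ?_⟩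
    obtain ⟨j, hj, hjc⟩ := Finset.mem_map.1 (hc v)
    exact ⟨j, hj, hsub j (by simpa using hjc.symm)⟩
  have hB : ∀ C ∈ Fintype.piFinset fun _ : Fin (2 * s) => 𝒞, ((B C).card : ℝ) ≤
      (P.card : ℝ) ^ Fintype.card V * Real.exp (-(Fintype.card V / (2 * 3 ^ t))) := by
    intro C hC
    rw [Fintype.mem_piFinset] at hC
    let T : V → Finset (Fin (2 * s)) := fun v => Finset.univ.filter fun j => v ∈ C j
    let good : Finset V := Finset.univ.filter fun v => (T v).card ≤ t
    have hsum : ∑ v, (T v).card ≤ 2 * s * M := by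
      have : ∑ v, (T v).card = ∑ j, (C j).card := by
        have := Finset.sum_card_bipartiteAbove_eq_sum_card_bipartiteBelow
          (s := (Finset.univ : Finset V)) (t := (Finset.univ : Finset (Fin (2 * s))))
          (fun v j => v ∈ C j)
        simpa [Finset.bipartiteAbove, Finset.bipartiteBelow, T] using this
      rw [this]
      refine (Finset.sum_le_card_nsmul _ _ M fun j _ => hM _ (hC j)).trans ?_
      simp
    have hgood : Fintype.card V ≤ 2 * good.card := by
      have h1 : (goodᶜ).card * (t + 1) ≤ ∑ v, (T v).card := by
        rw [← smul_eq_mul]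
        refine (Finset.card_nsmul_le_sum goodᶜ (fun v => (T v).card) (t + 1) fun v hv => ?_).trans
          (Finset.sum_le_sum_of_subset (Finset.subset_univ _))
        simp only [good, Finset.mem_compl, Finset.mem_filter, Finset.mem_univ, true_and] at hv
        omega
      have h2 := Finset.card_add_card_compl good
      have h3 : 2 * (goodᶜ).card ≤ Fintype.card V := by
        refine Nat.le_of_mul_le_mul_right (c := t + 1) ?_ (by omega)
        nlinarith
      omega
    have hv : ∀ v ∈ good, ((P.filter fun L => ∃ j ∈ L, v ∈ C j).card : ℝ) ≤
        P.card * Real.exp (-(1 / 3 ^ t)) := by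
      intro v hvg
      have hvt : (T v).card ≤ t := (Finset.mem_filter.1 hvg).2
      have h1 := Finset.card_filter_add_card_filter_not (s := P) (fun L => ∃ j ∈ L, v ∈ C j)
      have h2 : P.filter (fun L => ¬ ∃ j ∈ L, v ∈ C j) = (T v)ᶜ.powersetCard s := by
        ext L
        simp only [P, T, Finset.mem_filter, Finset.mem_powersetCard, true_and,
          Finset.subset_iff, Finset.mem_compl, Finset.mem_univ, not_exists, not_and]
        tauto
      rw [h2, Finset.card_powersetCard, Finset.card_compl, Fintype.card_fin] at h1
      have h3 := choose_le_three_pow_mul_choose (m := 2 * s) (s := s) (t := (T v).card) (by omega)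
      have h4 : P.card ≤ 3 ^ t * (2 * s - (T v).card).choose s := by
        rw [hPcard]
        exact h3.trans (Nat.mul_le_mul_right _ (Nat.pow_le_pow_right (by norm_num) hvt))
      have h1' : ((P.filter fun L => ∃ j ∈ L, v ∈ C j).card : ℝ) +
        ((2 * s - (T v).card).choose s : ℝ) = P.card := by exact_mod_cast h1
      have h4' : (P.card : ℝ) * (1 / 3 ^ t) ≤ ((2 * s - (T v).card).choose s : ℝ) := by
        rw [mul_one_div, div_le_iff₀' (by positivity)]
        exact_mod_cast h4
      have h5 := Real.add_one_le_exp (-(1 / 3 ^ t) : ℝ)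
      nlinarith
    have hcardB : ((B C).card : ℝ) = ∏ v, ((P.filter fun L => ∃ j ∈ L, v ∈ C j).card : ℝ) := by
      simp [B, Fintype.card_piFinset]
    have hprod : ((B C).card : ℝ) ≤
        ∏ v : V, P.card * (if v ∈ good then Real.exp (-(1 / 3 ^ t)) else 1) := by
      rw [hcardB]
      refine Finset.prod_le_prod (fun _ _ => Nat.cast_nonneg _) fun v _ => ?_
      split_ifs with hg
      · exact hv v hg
      · rw [mul_one]; exact_mod_cast Finset.card_filter_le _ _
    refine hprod.trans ?_
    rw [Finset.prod_mul_distrib, Finset.prod_const, Finset.card_univ, Finset.prod_ite_mem,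
      Finset.univ_inter, Finset.prod_const, ← Real.exp_nat_mul]
    gcongr
    have : (Fintype.card V : ℝ) ≤ 2 * good.card := by exact_mod_cast hgood
    rw [mul_neg, neg_le_neg_iff, mul_one_div, ← div_div]
    gcongr
    linarith
  have hne : 0 < 𝒞.card := by
    obtain ⟨C, hC, -⟩ := hcov ∅ (by simp)
    exact Finset.card_pos.2 ⟨C, hC⟩
  have h1 : ((P.card : ℝ) ^ Fintype.card V) ≤ (𝒞.card : ℝ) ^ (2 * s) *
      ((P.card : ℝ) ^ Fintype.card V * Real.exp (-(Fintype.card V / (2 * 3 ^ t)))) := by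
    have h := (Finset.card_le_card hcover).trans Finset.card_biUnion_le
    have h' : ((Fintype.piFinset (fun _ : V => P)).card : ℝ) ≤
        ∑ C ∈ Fintype.piFinset fun _ : Fin (2 * s) => 𝒞, ((B C).card : ℝ) := by exact_mod_cast h
    have h'' := h'.trans (Finset.sum_le_card_nsmul _ _ _ hB)
    simpa [Fintype.card_piFinset] using h''
  have h2 : (𝒞.card : ℝ) ^ (2 * s) = Real.exp (2 * s * Real.log 𝒞.card) := by
    have h0 : (0 : ℝ) < 𝒞.card := by exact_mod_cast hne
    rw [← Real.exp_log (pow_pos h0 (2 * s)), Real.log_pow]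
    push_cast
    rfl
  rw [h2, mul_left_comm, ← Real.exp_add] at h1
  have h3 : Real.exp (2 * s * Real.log 𝒞.card + -(Fintype.card V / (2 * 3 ^ t))) < 1 := by
    rw [Real.exp_lt_one_iff]; linarith
  have h4 : (0 : ℝ) < (P.card : ℝ) ^ Fintype.card V := by positivity
  nlinarith

/-- The graph on functions `ι → K` in which two functions are adjacent iff they agree nowhere. -/
def nowhereEqualGraph (ι K : Type*) [Nonempty ι] : SimpleGraph (ι → K) where
  Adj f g := ∀ i, f i ≠ g i
  symm := ⟨fun _ _ h i => (h i).symm⟩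
  loopless := ⟨fun _ h => h (Classical.arbitrary ι) rfl⟩

lemma nowhereEqualGraph_sum_degree_ge {K : Type*} [Field K] [Fintype K] [DecidableEq K]
    (κ : ℕ) (hκ : 2 * κ ≤ Fintype.card K)
    [DecidableRel (nowhereEqualGraph (Fin (κ + 1)) K).Adj] (A : Finset (Fin (κ + 1) → K))
    (hA : 2 * Fintype.card K ^ κ < A.card) :
    A.card ^ 2 ≤
      4 * ∑ f ∈ A, (A.filter ((nowhereEqualGraph (Fin (κ + 1)) K).Adj f)).card := by
  set E := ∑ f ∈ A, (A.filter ((nowhereEqualGraph (Fin (κ + 1)) K).Adj f)).card with hE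
  set q := Fintype.card K with hq
  have hq1 : 1 < q := Fintype.one_lt_card
  let line : (Fin (κ + 1) → K) × (Fin (κ + 1) → Kˣ) → K → Fin (κ + 1) → K :=
    fun p c i => p.1 i + c * p.2 i
  let X : (Fin (κ + 1) → K) × (Fin (κ + 1) → Kˣ) → ℕ :=
    fun p => (Finset.univ.filter fun c => line p c ∈ A).card
  have hunits : Fintype.card (Fin (κ + 1) → Kˣ) = (q - 1) ^ (κ + 1) := by
    rw [Fintype.card_fun, Fintype.card_units, Fintype.card_fin]
  have hpoint : ∀ c, (Finset.univ.filter fun p => line p c ∈ A).card =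
      A.card * (q - 1) ^ (κ + 1) := by
    intro c
    rw [← hunits, ← Finset.card_univ, ← Finset.card_product]
    refine Finset.card_bij' (fun p _ => (line p c, p.2))
      (fun p _ => (fun i => p.1 i - c * p.2 i, p.2)) ?_ ?_ ?_ ?_
    · intro p hp; simpa using hp
    · intro p hp; simpa [line] using hp
    · intro p _; simp [line]
    · intro p _; simp [line]
  have hpair : ∀ c d, c ≠ d →
      (Finset.univ.filter fun p => line p c ∈ A ∧ line p d ∈ A).card ≤ E := by
    intro c d hcd
    rw [hE, ← Finset.card_sigma]
    refine Finset.card_le_card_of_injOn (fun p => ⟨line p c, line p d⟩) ?_ ?_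
    · intro p hp
      simp only [Finset.coe_filter, Finset.mem_univ, true_and, Set.mem_ofPred_eq] at hp
      simp only [Finset.coe_sigma, Set.mem_sigma_iff, Finset.mem_coe, Finset.mem_filter]
      refine ⟨hp.1, hp.2, fun i hi => hcd ?_⟩
      exact mul_right_cancel₀ (p.2 i).ne_zero (add_left_cancel hi)
    · rintro ⟨f, g⟩ - ⟨f', g'⟩ - h
      simp only [Sigma.mk.injEq, heq_eq_eq] at h
      have hi : ∀ i, f i = f' i ∧ (g i : K) = g' i := by
        intro i
        have h1 : f i + c * g i = f' i + c * g' i := congrFun h.1 i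
        have h2 : f i + d * g i = f' i + d * g' i := congrFun h.2 i
        have h3 : (g i : K) = g' i := by
          refine mul_left_cancel₀ (sub_ne_zero.2 hcd) ?_
          linear_combination h1 - h2
        exact ⟨by rw [h3] at h1; exact add_right_cancel h1, h3⟩
      exact Prod.ext (funext fun i => (hi i).1) (funext fun i => Units.ext (hi i).2)
  have hXsum : ∑ p, X p = q * (A.card * (q - 1) ^ (κ + 1)) := by
    have := Finset.sum_card_bipartiteAbove_eq_sum_card_bipartiteBelow
      (s := Finset.univ) (t := (Finset.univ : Finset K)) (fun p c => line p c ∈ A)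
    simp only [Finset.bipartiteAbove, Finset.bipartiteBelow] at this
    simp only [X]
    rw [this, Finset.sum_congr rfl fun c _ => hpoint c, Finset.sum_const, Finset.card_univ,
      smul_eq_mul]
  have hXsq : ∑ p, X p ^ 2 ≤ q * (A.card * (q - 1) ^ (κ + 1)) + q * (q - 1) * E := by
    have h1 : ∀ p, X p ^ 2 =
        (Finset.univ.filter fun e : K × K => line p e.1 ∈ A ∧ line p e.2 ∈ A).card := by
      intro p
      rw [sq, ← Finset.card_product, ← Finset.filter_product, Finset.univ_product_univ]
    have h2 := Finset.sum_card_bipartiteAbove_eq_sum_card_bipartiteBelow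
      (s := Finset.univ) (t := (Finset.univ : Finset (K × K)))
      (fun p e => line p e.1 ∈ A ∧ line p e.2 ∈ A)
    simp only [Finset.bipartiteAbove, Finset.bipartiteBelow] at h2
    rw [Finset.sum_congr rfl fun p _ => h1 p, h2, ← Finset.univ_product_univ,
      Finset.sum_product]
    have h3 : ∀ c : K, ∑ d, (Finset.univ.filter fun p => line p c ∈ A ∧ line p d ∈ A).card ≤
        A.card * (q - 1) ^ (κ + 1) + (q - 1) * E := by
      intro c
      rw [← Finset.add_sum_erase _ _ (Finset.mem_univ c)]
      simp only [and_self]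
      rw [hpoint c]
      gcongr
      refine (Finset.sum_le_card_nsmul _ _ E fun d hd =>
        hpair c d (Finset.ne_of_mem_erase hd).symm).trans ?_
      rw [Finset.card_erase_of_mem (Finset.mem_univ c), Finset.card_univ, smul_eq_mul]
    refine (Finset.sum_le_card_nsmul _ _ _ fun c _ => h3 c).trans ?_
    rw [Finset.card_univ, smul_eq_mul, ← hq, mul_add, mul_assoc q (q - 1)]
  have hCS := sq_sum_le_card_mul_sum_sq (s := Finset.univ) (f := X)
  rw [hXsum, Finset.card_univ, Fintype.card_prod, hunits, Fintype.card_fun, Fintype.card_fin,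
    ← hq, Nat.cast_id] at hCS
  have hmain := hCS.trans (Nat.mul_le_mul_left _ hXsq)
  obtain ⟨r, hr⟩ : ∃ r, q = r + 1 := ⟨q - 1, by omega⟩
  have hr0 : 0 < r := by omega
  have hbern : q ^ κ ≤ 2 * r ^ κ := by
    have hqpos : (0 : ℝ) < q := by positivity
    have h1 := one_add_mul_le_pow (a := -(1 / q : ℝ)) (by
      have : (1 / q : ℝ) ≤ 1 := by
        rw [div_le_one hqpos]; exact_mod_cast hq1.le
      linarith) κ
    have h2 : (1 + -(1 / q : ℝ)) = r / q := by
      rw [hr]; push_cast; field_simp; ring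
    rw [h2, div_pow] at h1
    have h3 : (κ : ℝ) * (1 / q) ≤ 1 / 2 := by
      rw [mul_one_div, div_le_div_iff₀ hqpos (by norm_num)]
      exact_mod_cast (by omega : κ * 2 ≤ 1 * q)
    have h4 : (1 / 2 : ℝ) ≤ r ^ κ / q ^ κ := by linarith
    rw [div_le_div_iff₀ (by norm_num) (by positivity)] at h4
    have h5 : ((q ^ κ : ℕ) : ℝ) ≤ ((2 * r ^ κ : ℕ) : ℝ) := by push_cast; linarith
    exact_mod_cast h5
  have hrr : q - 1 = r := by omega
  rw [hrr] at hmain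
  have h1 : q * (r ^ κ * A.card ^ 2) ≤ q * (q ^ κ * (r ^ κ * A.card + E)) := by
    refine Nat.le_of_mul_le_mul_left (c := q * r ^ (κ + 1) * r) ?_ (by positivity)
    calc _ = (q * (A.card * r ^ (κ + 1))) ^ 2 := by ring
      _ ≤ _ := hmain
      _ = _ := by ring
  have h1' := Nat.le_of_mul_le_mul_left h1 (by omega)
  have h2 : r ^ κ * A.card ^ 2 ≤ 2 * (q ^ κ * E) := by
    have : 2 * q ^ κ * (r ^ κ * A.card) ≤ A.card * (r ^ κ * A.card) :=
      Nat.mul_le_mul_right _ hA.le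
    nlinarith
  refine Nat.le_of_mul_le_mul_left (c := q ^ κ) ?_ (by positivity)
  calc q ^ κ * A.card ^ 2 ≤ 2 * r ^ κ * A.card ^ 2 := by gcongr
    _ = 2 * (r ^ κ * A.card ^ 2) := by ring
    _ ≤ 2 * (2 * (q ^ κ * E)) := by gcongr
    _ = _ := by ring

lemma Choosable.nowhereEqualGraph {K : Type*} [Fintype K] {n k s : ℕ} [Nonempty (Fin k)]
    (hkq : k * Fintype.card K ≤ n)
    (h : Choosable (KneserGraph n k) s) : Choosable (nowhereEqualGraph (Fin k) K) s := by
  let e : Fin k × K ↪ Fin n :=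
    (((Equiv.refl _).prodCongr (Fintype.equivFin K)).trans finProdFinEquiv).toEmbedding.trans (Fin.castLEEmb hkq)
  let graph : (Fin k → K) → Fin k ↪ Fin n := fun f =>
    ⟨fun i => e (i, f i), fun i j hij => (Prod.ext_iff.1 (e.injective hij)).1⟩
  have hmem : ∀ f g i, graph f i ∈ Finset.univ.map (graph g) → f i = g i := by
    intro f g i hi
    obtain ⟨j, -, hj⟩ := Finset.mem_map.1 hi
    have := Prod.ext_iff.1 (e.injective hj)
    obtain rfl : j = i := this.1
    exact this.2.symm
  have hdisj : ∀ f g, (∀ i, f i ≠ g i) →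
      Disjoint (Finset.univ.map (graph f)) (Finset.univ.map (graph g)) := by
    intro f g hfg
    rw [Finset.disjoint_left]
    intro x hx hx'
    obtain ⟨i, -, rfl⟩ := Finset.mem_map.1 hx
    exact hfg i (hmem f g i hx')
  have hinj : Function.Injective fun f => (⟨Finset.univ.map (graph f), by simp⟩ :
      {v : Finset (Fin n) // v.card = k}) := by
    intro f g hfg
    have hfg' : Finset.univ.map (graph f) = Finset.univ.map (graph g) := congrArg Subtype.val hfg
    funext i
    exact hmem f g i (hfg' ▸ Finset.mem_map_of_mem _ (Finset.mem_univ i))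
  refine h.of_injective_hom _ hinj fun f g hfg => ?_
  rw [KneserGraph, SimpleGraph.fromRel_adj]
  exact ⟨fun heq => hfg (Classical.arbitrary _) (congrFun (hinj heq) _), Or.inl (hdisj f g hfg)⟩

lemma kneserGraph_not_choosable {n k s : ℕ} (hn : 256 ≤ n) (hk : 3 ≤ k) (hkn : 4 * k ^ 2 ≤ n)
    (hlog : 3 ≤ Real.log n) (hlog3 : Real.log n ^ 3 ≤ Real.exp (Real.log n / 5))
    (hs : (s : ℝ) ≤ n * Real.log n / 320) : ¬ Choosable (KneserGraph n k) s := by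
  classical
  intro hch
  obtain ⟨κ, rfl⟩ : ∃ κ, k = κ + 1 := ⟨k - 1, by omega⟩
  set k := κ + 1 with hkdef
  have hdiv : n / (2 * k) ≠ 0 := by
    rw [Nat.div_ne_zero_iff]
    exact ⟨by omega, by nlinarith⟩
  obtain ⟨p, hp, hlt, hle⟩ := Nat.exists_prime_lt_and_le_two_mul _ hdiv
  have hkp : k * p ≤ n := by
    calc k * p ≤ k * (2 * (n / (2 * k))) := by gcongr
      _ = n / (2 * k) * (2 * k) := by ring
      _ ≤ n := Nat.div_mul_le_self _ _
  have hnp : n < p * (2 * k) := (Nat.div_lt_iff_lt_mul (by omega)).1 hlt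
  have h2kp : 2 * k < p := by
    by_contra! h
    nlinarith
  have hnp2 : n < p ^ 2 := by nlinarith
  have hp16 : 16 ≤ p := by
    by_contra! h
    nlinarith
  have hpn : p + 1 ≤ n := by nlinarith
  have : Fact p.Prime := ⟨hp⟩
  have hcardK : Fintype.card (ZMod p) = p := ZMod.card p
  replace hch := hch.nowhereEqualGraph (K := ZMod p) (by rw [hcardK]; exact hkp)
  have hcardV : Fintype.card (Fin k → ZMod p) = p ^ k := by
    rw [Fintype.card_fun, hcardK, Fintype.card_fin]
  set l := Real.log n with hl
  have hn0 : (0 : ℝ) < n := by exact_mod_cast (by omega : 0 < n)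
  have hp0 : (0 : ℝ) < p := by exact_mod_cast hp.pos
  have hexpl : Real.exp l = n := Real.exp_log hn0
  let L := ⌈8 * Real.log p⌉₊
  have hlogp : Real.log p ≤ l := Real.log_le_log hp0 (by exact_mod_cast (by omega : p ≤ n))
  have hL1 : (L : ℝ) ≤ 9 * l := by
    have := Nat.ceil_lt_add_one (a := 8 * Real.log p)
      (mul_nonneg (by norm_num) (Real.log_natCast_nonneg p))
    linarith
  have hL2 : 7 ^ L * p ≤ 8 ^ L := by
    have h1 : (7 / 8 : ℝ) ^ L ≤ Real.exp (-(1 / 8)) ^ L := by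
      gcongr
      linarith [Real.add_one_le_exp (-(1 / 8) : ℝ)]
    have h2 : Real.exp (-(1 / 8)) ^ L ≤ (p : ℝ)⁻¹ := by
      rw [← Real.exp_nat_mul, ← Real.exp_log (inv_pos.2 hp0), Real.log_inv]
      gcongr
      have := Nat.le_ceil (8 * Real.log p)
      linarith
    have h3 := h1.trans h2
    rw [div_pow, div_le_iff₀ (by positivity), inv_mul_eq_div, le_div_iff₀ hp0] at h3
    exact_mod_cast h3
  obtain ⟨𝒞, hcard, h𝒞⟩ := exists_containers (nowhereEqualGraph (Fin k) (ZMod p)) (2 * p ^ κ)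
    (fun A hA => nowhereEqualGraph_sum_degree_ge κ (by rw [hcardK]; omega) A
      (by rw [hcardK]; exact hA)) L
  rw [hcardV] at hcard h𝒞
  have hcover : ∀ I : Finset (Fin k → ZMod p),
      (∀ u ∈ I, ∀ v ∈ I, ¬ (nowhereEqualGraph (Fin k) (ZMod p)).Adj u v) →
      ∃ C ∈ 𝒞.filter fun C => C.card ≤ 2 * p ^ κ, I ⊆ C := by
    intro I hI
    obtain ⟨C, hC, hIC, hsize⟩ := h𝒞 I hI
    refine ⟨C, Finset.mem_filter.2 ⟨hC, hsize.elim id fun h => ?_⟩, hIC⟩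
    have h1 : 8 ^ L * C.card ≤ 8 ^ L * p ^ κ := by
      calc 8 ^ L * C.card ≤ 7 ^ L * p ^ k := h
        _ = 7 ^ L * p * p ^ κ := by rw [hkdef]; ring
        _ ≤ _ := by gcongr
    have h2 := Nat.le_of_mul_le_mul_left h1 (by positivity)
    omega
  refine not_choosable_of_containers _ _ (2 * p ^ κ) s (8 * s / p) hcover
    (fun C hC => (Finset.mem_filter.1 hC).2) ?_ ?_ ?_ hch
  · have h1 : 8 * s < p * (8 * s / p + 1) := Nat.lt_mul_div_succ _ hp.pos
    rw [hcardV, hkdef]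
    calc 4 * s * (2 * p ^ κ) = 8 * s * p ^ κ := by ring
      _ ≤ p * (8 * s / p + 1) * p ^ κ := by gcongr
      _ = _ := by ring
  · have h1 : 8 * s / p * p ≤ 8 * s := Nat.div_mul_le_self _ _
    nlinarith [Nat.zero_le (8 * s / p)]
  have hk0 : (0 : ℝ) < k := by positivity
  have hk3 : (3 : ℝ) ≤ k := by exact_mod_cast hk
  have hlogC : Real.log (𝒞.filter fun C => C.card ≤ 2 * p ^ κ).card ≤ 9 * k * l ^ 2 := by
    have hpos : 0 < (𝒞.filter fun C => C.card ≤ 2 * p ^ κ).card := by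
      obtain ⟨C, hC, -⟩ := hcover ∅ (by simp)
      exact Finset.card_pos.2 ⟨C, hC⟩
    have h1 : (𝒞.filter fun C => C.card ≤ 2 * p ^ κ).card ≤ (n ^ k) ^ L := by
      refine (Finset.card_filter_le _ _).trans (hcard.trans ?_)
      gcongr
      calc p ^ k + 1 = p ^ k + 1 ^ k := by rw [one_pow]
        _ ≤ (p + 1) ^ k := pow_add_pow_le (by omega) (by omega) (by omega)
        _ ≤ n ^ k := by gcongr
    have h2 := Real.log_le_log (by exact_mod_cast hpos)
      (by exact_mod_cast h1 : ((𝒞.filter fun C => C.card ≤ 2 * p ^ κ).card : ℝ) ≤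
        ((n : ℝ) ^ k) ^ L)
    rw [Real.log_pow, Real.log_pow, ← hl] at h2
    refine h2.trans ?_
    calc (L : ℝ) * (k * l) ≤ 9 * l * (k * l) := by gcongr
      _ = _ := by ring
  have ht : ((8 * s / p : ℕ) : ℝ) ≤ k * l / 20 := by
    refine Nat.cast_div_le.trans ?_
    rw [div_le_iff₀ hp0]
    push_cast
    have h1 : (n : ℝ) ≤ p * (2 * k) := by exact_mod_cast hnp.le
    have h2 : n * l ≤ p * (2 * k) * l := by gcongr
    linarith
  have h3t : (3 : ℝ) ^ (8 * s / p) ≤ Real.exp (k * l / 10) := by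
    calc (3 : ℝ) ^ (8 * s / p) ≤ Real.exp 2 ^ (8 * s / p) := by
          gcongr
          linarith [Real.add_one_le_exp (2 : ℝ)]
      _ = Real.exp ((8 * s / p : ℕ) * 2) := by rw [← Real.exp_nat_mul]
      _ ≤ _ := by gcongr; linarith
  have hV : Real.exp (k * l / 2) ≤ (p : ℝ) ^ k := by
    have h1 : l ≤ 2 * Real.log p := by
      have := Real.log_le_log hn0 (by exact_mod_cast hnp2.le : (n : ℝ) ≤ (p : ℝ) ^ 2)
      rwa [Real.log_pow] at this
    rw [← Real.exp_log (pow_pos hp0 k), Real.log_pow]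
    gcongr
    nlinarith
  have hfrac : Real.exp (2 * (k * l) / 5) / 2 ≤ (p : ℝ) ^ k / (2 * 3 ^ (8 * s / p)) := by
    rw [div_le_div_iff₀ (by norm_num) (by positivity)]
    calc Real.exp (2 * (k * l) / 5) * (2 * 3 ^ (8 * s / p))
        ≤ Real.exp (2 * (k * l) / 5) * (2 * Real.exp (k * l / 10)) := by gcongr
      _ = Real.exp (2 * (k * l) / 5 + k * l / 10) * 2 := by rw [Real.exp_add]; ring
      _ = Real.exp (k * l / 2) * 2 := by ring_nf
      _ ≤ _ := by gcongr
  have hexp : n * l ^ 3 * (k / 3) ≤ Real.exp (2 * (k * l) / 5) := by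
    have h1 : (k : ℝ) / 3 ≤ Real.exp (2 * l / 5 * (k - 3)) := by
      have := Real.add_one_le_exp (2 * l / 5 * (k - 3))
      nlinarith
    calc n * l ^ 3 * (k / 3)
        ≤ n * Real.exp (l / 5) * Real.exp (2 * l / 5 * (k - 3)) := by gcongr
      _ = Real.exp (l + l / 5 + 2 * l / 5 * (k - 3)) := by
        rw [Real.exp_add, Real.exp_add, hexpl]
      _ = _ := by ring_nf
  rw [hcardV]
  push_cast
  refine lt_of_lt_of_le ?_ hfrac
  have hpos : 0 < n * l ^ 3 * k := by positivity
  calc 2 * (s : ℝ) * Real.log (𝒞.filter fun C => C.card ≤ 2 * p ^ κ).card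
      ≤ 2 * (n * l / 320) * (9 * k * l ^ 2) := by gcongr
    _ = (n * l ^ 3 * k) * (18 / 320) := by ring
    _ < (n * l ^ 3 * k) / 6 := by linarith
    _ ≤ _ := by linarith

lemma kneserGraph_choosable_of_two_mul_log_le {n k s : ℕ} (hn : 2 ≤ n) (hk : 0 < k)
    (hs : 2 * n * Real.log n ≤ s) : Choosable (KneserGraph n k) s := by
  have hn0 : (0 : ℝ) < n := by exact_mod_cast (by omega : 0 < n)
  have hl : 0 < Real.log n := Real.log_pos (by exact_mod_cast (by omega : 1 < n))
  have hk0 : (0 : ℝ) < k := by exact_mod_cast hk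
  refine kneserGraph_choosable (by omega) ?_
  have h1 : (n.choose k : ℝ) ≤ Real.exp (k * Real.log n) := by
    rw [Real.exp_nat_mul, Real.exp_log hn0]
    exact_mod_cast Nat.choose_le_pow n k
  have h2 : 2 * (k * Real.log n) ≤ k * s / n := by
    rw [le_div_iff₀ hn0]
    nlinarith
  calc (n.choose k : ℝ) * Real.exp (-(k * s / n))
      ≤ Real.exp (k * Real.log n) * Real.exp (-(2 * (k * Real.log n))) := by gcongr
    _ = Real.exp (-(k * Real.log n)) := by rw [← Real.exp_add]; ring_nf
    _ < 1 := by rw [Real.exp_lt_one_iff]; nlinarith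

/-- Main result: for every `0 < ε < 1/2`, if `3 ≤ k ≤ n^(1/2 - ε)` and `n` is large,
then `ch(KG_{n,k}) = Θ(n·log n)`. -/
theorem stmt_4 (ε : ℝ) (hε : 0 < ε) (hε2 : ε < 1 / 2) :
    ∃ c C : ℝ, 0 < c ∧ 0 < C ∧ ∃ N : ℕ, ∀ n : ℕ, N ≤ n → ∀ k : ℕ, 3 ≤ k →
      (k : ℝ) ≤ (n : ℝ) ^ ((1 : ℝ) / 2 - ε) →
      c * n * Real.log n ≤ (choiceNumber (KneserGraph n k) : ℝ) ∧
      (choiceNumber (KneserGraph n k) : ℝ) ≤ C * n * Real.log n := by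
  have hlog_tendsto : Filter.Tendsto (fun n : ℕ => Real.log n) Filter.atTop Filter.atTop :=
    Real.tendsto_log_atTop.comp tendsto_natCast_atTop_atTop
  have hev : ∀ᶠ n : ℕ in Filter.atTop, 640 ≤ n ∧ 3 ≤ Real.log n ∧
      Real.log n ^ 3 ≤ Real.exp (Real.log n / 5) ∧ 4 ≤ (n : ℝ) ^ (2 * ε) := by
    refine (Filter.eventually_ge_atTop 640).and
      ((hlog_tendsto.eventually_ge_atTop 3).and (Filter.Eventually.and ?_ ?_))
    · have h1 := (isLittleO_pow_exp_pos_mul_atTop 3 (by norm_num : (0 : ℝ) < 1 / 5)).bound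
        one_pos
      filter_upwards [hlog_tendsto.eventually h1] with n hn
      rw [one_mul, Real.norm_eq_abs, Real.norm_eq_abs, abs_of_pos (Real.exp_pos _),
        one_div_mul_eq_div] at hn
      exact (le_abs_self _).trans hn
    · exact ((tendsto_rpow_atTop (by linarith)).comp
        tendsto_natCast_atTop_atTop).eventually_ge_atTop 4
  obtain ⟨N, hN⟩ := Filter.eventually_atTop.1 hev
  refine ⟨1 / 640, 3, by norm_num, by norm_num, N, fun n hn k hk hkn => ?_⟩
  obtain ⟨hn1, hl, hl3, hn4⟩ := hN n hn
  have hn0 : (640 : ℝ) ≤ n := by exact_mod_cast hn1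
  have hnl : 640 ≤ n * Real.log n := by nlinarith
  have hkn' : 4 * k ^ 2 ≤ n := by
    have h1 : (k : ℝ) ^ 2 ≤ (n : ℝ) ^ (1 - 2 * ε) := by
      calc (k : ℝ) ^ 2 ≤ ((n : ℝ) ^ ((1 : ℝ) / 2 - ε)) ^ 2 := by gcongr
        _ = _ := by
          rw [← Real.rpow_mul_natCast (by positivity)]
          congr 1
          push_cast
          ring
    have h2 : (n : ℝ) ^ (1 - 2 * ε) * (n : ℝ) ^ (2 * ε) = n := by
      rw [← Real.rpow_add (by linarith)]; simp
    have h3 : 4 * (k : ℝ) ^ 2 ≤ n := by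
      rw [← h2, mul_comm]
      gcongr
    exact_mod_cast h3
  have hup : Choosable (KneserGraph n k) ⌈2 * n * Real.log n⌉₊ :=
    kneserGraph_choosable_of_two_mul_log_le (by omega) (by omega) (Nat.le_ceil _)
  constructor
  · have hlow : ¬ Choosable (KneserGraph n k) ⌈1 / 640 * n * Real.log n⌉₊ := by
      refine kneserGraph_not_choosable (by omega) hk hkn' hl hl3 ?_
      have := Nat.ceil_lt_add_one (a := 1 / 640 * n * Real.log n) (by positivity)
      linarith
    by_contra! hlt
    have hmem : Choosable (KneserGraph n k) (choiceNumber (KneserGraph n k)) :=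
      Nat.sInf_mem (s := {s | Choosable (KneserGraph n k) s}) ⟨_, hup⟩
    refine hlow (hmem.mono ?_)
    exact_mod_cast hlt.le.trans (Nat.le_ceil _)
  · have h1 : (choiceNumber (KneserGraph n k) : ℝ) ≤ ⌈2 * n * Real.log n⌉₊ := by
      exact_mod_cast Nat.sInf_le (s := {s | Choosable (KneserGraph n k) s}) hup
    have := Nat.ceil_lt_add_one (a := 2 * n * Real.log n) (by positivity)
    linarith
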